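/- Lens theorem (decreasing curvature): Let c > 0 and let f : ℝ → ℝ be twice continuously differentiable on [−c, c] with f(−c) = f(c) = 0, and suppose the signed curvature κ(x) = f''(x)/(1 + f'(x)^2)^(3/2) is strictly decreasing on [−c, c]. Then for every x with |x| < c, A(x; c, α) < f(x) < A(x; c, −β), where α = arctan(f'(−c)) and β = arctan(f'(c)). -/

import Mathlib

/-- Signed curvature of the graph of `f` at abscissa `x`:
`κ(x) = f''(x) / (1 + f'(x)^2)^(3/2)`. -/
noncomputable def graphCurvature (f : ℝ → ℝ) (x : ℝ) : ℝ :=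
  deriv (deriv f) x / (1 + deriv f x ^ 2) ^ ((3 : ℝ) / 2)

/-- The circular arc from `(−c, 0)` to `(c, 0)` whose tangent at `(−c, 0)`
makes angle `φ` with the positive `x`-axis, as a function of `x`. -/
noncomputable def arcA (c φ x : ℝ) : ℝ :=
  ((c ^ 2 - x ^ 2) * Real.sin φ) /
    (c * Real.cos φ + Real.sqrt (c ^ 2 - x ^ 2 * Real.sin φ ^ 2))

open Set Filter Topology

/-- A function vanishing at both ends of `[a, b]` and nonpositive at an interior point `x` has
nonpositive slope somewhere before `x` and nonnegative slope somewhere after `x`. -/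
theorem exists_slope_nonpos_and_nonneg {a b x : ℝ} {u u' : ℝ → ℝ}
    (hu : ContinuousOn u (Icc a b)) (hu' : ∀ y ∈ Ioo a b, HasDerivAt u (u' y) y)
    (ha : u a = 0) (hb : u b = 0) (hx : x ∈ Ioo a b) (hux : u x ≤ 0) :
    ∃ y z, a < y ∧ y < z ∧ z < b ∧ u' y ≤ 0 ∧ 0 ≤ u' z := by
  obtain ⟨y, hy, hy'⟩ := exists_hasDerivAt_eq_slope u u' hx.1
    (hu.mono (Icc_subset_Icc_right hx.2.le)) fun t ht => hu' t ⟨ht.1, ht.2.trans hx.2⟩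
  obtain ⟨z, hz, hz'⟩ := exists_hasDerivAt_eq_slope u u' hx.2
    (hu.mono (Icc_subset_Icc_left hx.1.le)) fun t ht => hu' t ⟨hx.1.trans ht.1, ht.2⟩
  refine ⟨y, z, hy.1, hy.2.trans hz.1, hz.2, ?_, ?_⟩
  · rw [hy', ha]
    exact div_nonpos_of_nonpos_of_nonneg (by linarith) (by linarith [hx.1])
  · rw [hz', hb]
    exact div_nonneg (by linarith) (by linarith [hx.2])

theorem sin_arctan_mono {s t : ℝ} (h : s ≤ t) :
    Real.sin (Real.arctan s) ≤ Real.sin (Real.arctan t) :=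
  Real.sin_le_sin_of_le_of_le_pi_div_two (Real.neg_pi_div_two_lt_arctan s).le
    (Real.arctan_lt_pi_div_two t).le (Real.arctan_strictMono.monotone h)

/-- The sine of the tangent angle of a graph has the signed curvature as its derivative. -/
theorem hasDerivAt_sin_arctan_slope {g : ℝ → ℝ} {g' x : ℝ} (hg : HasDerivAt g g' x) :
    HasDerivAt (fun y => Real.sin (Real.arctan (g y)))
      (g' / (1 + g x ^ 2) ^ ((3 : ℝ) / 2)) x := by
  have h0 : 0 < 1 + g x ^ 2 := by positivity
  convert hg.arctan.sin using 1
  rw [Real.cos_arctan, show (3 : ℝ) / 2 = 1 + 1 / 2 by norm_num, Real.rpow_add h0,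
    Real.rpow_one, ← Real.sqrt_eq_rpow]
  have := Real.sqrt_pos.2 h0
  field_simp

theorem arcA_radicand_pos {c φ x : ℝ} (hφ : 0 < Real.cos φ) (hc : 0 < c)
    (hx : x ∈ Icc (-c) c) : 0 < c ^ 2 - x ^ 2 * Real.sin φ ^ 2 := by
  have h1 : x ^ 2 ≤ c ^ 2 := sq_le_sq' hx.1 hx.2
  nlinarith [Real.sin_sq_add_cos_sq φ, sq_nonneg (Real.sin φ),
    mul_pos (pow_pos hc 2) (pow_pos hφ 2)]

theorem hasDerivAt_arcA {c φ x : ℝ} (hφ : 0 < Real.cos φ) (hc : 0 < c)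
    (hx : x ∈ Icc (-c) c) :
    HasDerivAt (arcA c φ)
      (-(x * Real.sin φ) / Real.sqrt (c ^ 2 - x ^ 2 * Real.sin φ ^ 2)) x := by
  have hpos := arcA_radicand_pos hφ hc hx
  have hR := Real.sqrt_pos.2 hpos
  have hRsq := Real.sq_sqrt hpos.le
  have hck := mul_pos hc hφ
  have hrad : HasDerivAt (fun y : ℝ => c ^ 2 - y ^ 2 * Real.sin φ ^ 2)
      (-(2 * x * Real.sin φ ^ 2)) x := by
    simpa using ((hasDerivAt_pow 2 x).mul_const (Real.sin φ ^ 2)).const_sub (c ^ 2)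
  have hnum : HasDerivAt (fun y : ℝ => (c ^ 2 - y ^ 2) * Real.sin φ)
      (-(2 * x) * Real.sin φ) x := by
    simpa using ((hasDerivAt_pow 2 x).const_sub (c ^ 2)).mul_const (Real.sin φ)
  have h := hnum.div ((hrad.sqrt hpos.ne').const_add (c * Real.cos φ)) (by positivity)
  refine h.congr_deriv ?_
  set R := Real.sqrt (c ^ 2 - x ^ 2 * Real.sin φ ^ 2)
  have hne : c * Real.cos φ + R ≠ 0 := by positivity
  have key : (c ^ 2 - x ^ 2) * Real.sin φ ^ 2 = R ^ 2 - (c * Real.cos φ) ^ 2 := by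
    rw [hRsq, mul_pow, Real.cos_sq']; ring
  rw [div_eq_div_iff (by positivity) hR.ne']
  field_simp
  linear_combination x * Real.sin φ * key

/-- The sine of the tangent angle of a circular arc is linear in the abscissa. -/
theorem sin_arctan_slope_arcA {c φ x : ℝ} (hφ : 0 < Real.cos φ) (hc : 0 < c)
    (hx : x ∈ Icc (-c) c) :
    Real.sin (Real.arctan
      (-(x * Real.sin φ) / Real.sqrt (c ^ 2 - x ^ 2 * Real.sin φ ^ 2))) =
      -(x * Real.sin φ) / c := by
  have hpos := arcA_radicand_pos hφ hc hx
  have hR := Real.sqrt_pos.2 hpos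
  have hRsq := Real.sq_sqrt hpos.le
  set R := Real.sqrt (c ^ 2 - x ^ 2 * Real.sin φ ^ 2)
  have h : 1 + (-(x * Real.sin φ) / R) ^ 2 = (c / R) ^ 2 := by
    field_simp
    rw [hRsq]; ring
  rw [Real.sin_arctan, h, Real.sqrt_sq (by positivity)]
  field_simp

theorem arcA_neg_angle (c φ x : ℝ) : arcA c (-φ) x = -arcA c φ x := by
  simp [arcA, neg_div]

theorem arcA_neg_abscissa (c φ x : ℝ) : arcA c φ (-x) = arcA c φ x := by
  simp [arcA]

theorem pos_of_deriv2_neg {a b : ℝ} {f g g' : ℝ → ℝ}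
    (hf : ContinuousOn f (Icc a b)) (hfg : ∀ x ∈ Ioo a b, HasDerivAt f (g x) x)
    (hgg : ∀ x ∈ Ioo a b, HasDerivAt g (g' x) x) (ha : f a = 0) (hb : f b = 0)
    (hneg : ∀ x ∈ Ioo a b, g' x < 0) {x : ℝ} (hx : x ∈ Ioo a b) : 0 < f x := by
  by_contra! hle
  obtain ⟨y, z, hay, hyz, hzb, hy, hz⟩ := exists_slope_nonpos_and_nonneg hf hfg ha hb hx hle
  obtain ⟨ξ, hξ, hslope⟩ := exists_hasDerivAt_eq_slope g g' hyz
    (fun t ht => (hgg t ⟨hay.trans_le ht.1, ht.2.trans_lt hzb⟩).continuousAt.continuousWithinAt)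
    (fun t ht => hgg t ⟨hay.trans ht.1, ht.2.trans hzb⟩)
  have := hneg ξ ⟨hay.trans hξ.1, hξ.2.trans hzb⟩
  rw [hslope] at this
  exact absurd this (not_lt.2 (div_nonneg (by linarith) (by linarith)))

/-- A spiral arc of decreasing curvature lies above the circular arc sharing its chord and its
initial tangent. -/
theorem arcA_lt_of_strictAntiOn_curvature {c : ℝ} (hc : 0 < c) {f g g' : ℝ → ℝ}
    (hf : ContinuousOn f (Icc (-c) c)) (hg : ContinuousOn g (Icc (-c) c))
    (hfg : ∀ x ∈ Ioo (-c) c, HasDerivAt f (g x) x)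
    (hgg : ∀ x ∈ Ioo (-c) c, HasDerivAt g (g' x) x)
    (hfl : f (-c) = 0) (hfr : f c = 0)
    (hκ : StrictAntiOn (fun x => g' x / (1 + g x ^ 2) ^ ((3 : ℝ) / 2)) (Ioo (-c) c))
    {x : ℝ} (hx : x ∈ Ioo (-c) c) : arcA c (Real.arctan (g (-c))) x < f x := by
  by_contra! hle
  set φ := Real.arctan (g (-c)) with hφdef
  have hφ : 0 < Real.cos φ := Real.cos_arctan_pos _
  have hend : arcA c φ c = 0 := by simp [arcA]
  obtain ⟨y, z, hay, hyz, hzb, hy, hz⟩ := exists_slope_nonpos_and_nonneg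
    (u := fun t => f t - arcA c φ t)
    (hf.sub fun t ht => (hasDerivAt_arcA hφ hc ht).continuousAt.continuousWithinAt)
    (fun t ht => (hfg t ht).sub (hasDerivAt_arcA hφ hc (Ioo_subset_Icc_self ht)))
    (by simp [arcA_neg_abscissa, hfl, hend]) (by simp [hfr, hend]) hx (by linarith)
  let D : ℝ → ℝ := fun t => Real.sin (Real.arctan (g t)) - -(t * Real.sin φ) / c
  have hD : ∀ t ∈ Ioo (-c) c, HasDerivAt D
      (g' t / (1 + g t ^ 2) ^ ((3 : ℝ) / 2) - -(1 * Real.sin φ) / c) t := fun t ht =>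
    (hasDerivAt_sin_arctan_slope (hgg t ht)).sub
      (((hasDerivAt_id t).mul_const (Real.sin φ)).neg.div_const c)
  have hDc : ContinuousOn D (Icc (-c) c) :=
    ((Real.continuous_sin.comp Real.continuous_arctan).comp_continuousOn hg).sub
      (by fun_prop)
  have hD0 : D (-c) = 0 := by
    simp only [D, ← hφdef]
    field_simp
    ring
  have hyI : y ∈ Icc (-c) c := ⟨hay.le, (hyz.trans hzb).le⟩
  have hzI : z ∈ Icc (-c) c := ⟨(hay.trans hyz).le, hzb.le⟩
  have hDy : D y ≤ 0 := by
    have := sin_arctan_mono (sub_nonpos.1 hy)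
    rw [sin_arctan_slope_arcA hφ hc hyI] at this
    exact sub_nonpos.2 this
  have hDz : 0 ≤ D z := by
    have := sin_arctan_mono (sub_nonneg.1 hz)
    rw [sin_arctan_slope_arcA hφ hc hzI] at this
    exact sub_nonneg.2 this
  obtain ⟨ξ, hξ, hξs⟩ := exists_hasDerivAt_eq_slope D _ hay
    (hDc.mono (Icc_subset_Icc_right hyI.2)) fun t ht => hD t ⟨ht.1, ht.2.trans_le hyI.2⟩
  obtain ⟨η, hη, hηs⟩ := exists_hasDerivAt_eq_slope D _ hyz
    (hDc.mono (Icc_subset_Icc hyI.1 hzI.2)) fun t ht => hD t ⟨hay.trans ht.1, ht.2.trans hzb⟩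
  have h1 : (D y - D (-c)) / (y - -c) ≤ 0 :=
    div_nonpos_of_nonpos_of_nonneg (by linarith) (by linarith)
  have h2 : 0 ≤ (D z - D y) / (z - y) := div_nonneg (by linarith) (by linarith)
  have h3 := hκ ⟨hξ.1, hξ.2.trans_le hyI.2⟩ ⟨hay.trans hη.1, hη.2.trans hzb⟩ (hξ.2.trans hη.1)
  simp only at h3
  linarith

/-- Where the two-sided derivative of a `C²` function on `[a, b]` disagrees with the derivative
within `[a, b]`, both it and the signed curvature take their default value `0`. -/
theorem deriv_eq_zero_and_graphCurvature_eq_zero {a b e : ℝ} (hab : a < b) {f : ℝ → ℝ}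
    (hf : ContDiffOn ℝ 2 f (Icc a b)) (he : e ∈ Icc a b)
    (hne : deriv f e ≠ derivWithin f (Icc a b) e) :
    deriv f e = 0 ∧ graphCurvature f e = 0 := by
  have hud := uniqueDiffOn_Icc hab
  have hnd : ¬ DifferentiableAt ℝ f e := fun h => hne (h.derivWithin (hud e he)).symm
  have hd0 := deriv_zero_of_not_differentiableAt hnd
  refine ⟨hd0, ?_⟩
  suffices deriv (deriv f) e = 0 by simp [graphCurvature, this]
  refine deriv_zero_of_not_differentiableAt fun hdd => hne ?_
  have : (𝓝[Ioo a b] e).NeBot :=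
    mem_closure_iff_nhdsWithin_neBot.1 (by rwa [closure_Ioo hab.ne])
  have h1 : Tendsto (deriv f) (𝓝[Ioo a b] e) (𝓝 (deriv f e)) :=
    hdd.continuousAt.mono_left nhdsWithin_le_nhds
  have h2 : Tendsto (derivWithin f (Icc a b)) (𝓝[Ioo a b] e)
      (𝓝 (derivWithin f (Icc a b) e)) :=
    ((hf.continuousOn_derivWithin hud (by norm_num)) e he).mono_left
      (nhdsWithin_mono e Ioo_subset_Icc_self)
  refine tendsto_nhds_unique h1 (h2.congr' ?_)
  filter_upwards [self_mem_nhdsWithin] with t ht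
  exact derivWithin_of_mem_nhds (Icc_mem_nhds ht.1 ht.2)

/-- Lens theorem for a spiral arc with strictly decreasing curvature:
`A(x; c, α) < f(x) < A(x; c, −β)` for `|x| < c`. -/
theorem lens_theorem_decreasing (c : ℝ) (hc : 0 < c) (f : ℝ → ℝ)
    (hf : ContDiffOn ℝ 2 f (Set.Icc (-c) c))
    (hfl : f (-c) = 0) (hfr : f c = 0)
    (hmono : StrictAntiOn (graphCurvature f) (Set.Icc (-c) c)) :
    ∀ x : ℝ, |x| < c →
      arcA c (Real.arctan (deriv f (-c))) x < f x ∧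
      f x < arcA c (-Real.arctan (deriv f c)) x := by
  intro x hx
  have hxI : x ∈ Ioo (-c) c := abs_lt.1 hx
  have hnxI : -x ∈ Ioo (-c) c := ⟨by linarith [hxI.2], by linarith [hxI.1]⟩
  have hcc : -c < c := by linarith
  have hneg : ∀ t ∈ Ioo (-c) c, -t ∈ Ioo (-c) c := fun t ht =>
    ⟨by linarith [ht.2], by linarith [ht.1]⟩
  have hmaps : MapsTo (fun t : ℝ => -t) (Icc (-c) c) (Icc (-c) c) := fun t ht =>
    ⟨by linarith [ht.2], by linarith [ht.1]⟩
  have hud := uniqueDiffOn_Icc hcc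
  set g := derivWithin f (Icc (-c) c)
  have hgC : ContDiffOn ℝ 1 g (Icc (-c) c) := hf.derivWithin hud (by norm_num)
  have hfg : ∀ t ∈ Ioo (-c) c, HasDerivAt f (g t) t := fun t ht =>
    ((hf.differentiableOn (by norm_num)) t (Ioo_subset_Icc_self ht)).hasDerivWithinAt.hasDerivAt
      (Icc_mem_nhds ht.1 ht.2)
  have hgg : ∀ t ∈ Ioo (-c) c, HasDerivAt g (deriv (deriv f) t) t := fun t ht => by
    have hev : deriv f =ᶠ[𝓝 t] g := by
      filter_upwards [Ioo_mem_nhds ht.1 ht.2] with s hs using (hfg s hs).deriv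
    rw [hev.deriv_eq]
    exact ((hgC.contDiffAt (Icc_mem_nhds ht.1 ht.2)).differentiableAt (by norm_num)).hasDerivAt
  have hκ : ∀ t ∈ Ioo (-c) c,
      graphCurvature f t = deriv (deriv f) t / (1 + g t ^ 2) ^ ((3 : ℝ) / 2) := fun t ht => by
    rw [graphCurvature, (hfg t ht).deriv]
  have hden : ∀ t, 0 < (1 + g t ^ 2) ^ ((3 : ℝ) / 2) := fun t => by positivity
  have hl : -c ∈ Icc (-c) c := left_mem_Icc.2 hcc.le
  have hr : c ∈ Icc (-c) c := right_mem_Icc.2 hcc.le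
  have hfg' : ∀ t ∈ Ioo (-c) c, HasDerivAt (fun s => -f (-s)) (g (-t)) t := fun t ht =>
    ((hfg (-t) (hneg t ht)).comp t (hasDerivAt_neg t)).neg.congr_deriv (by simp)
  have hgg' : ∀ t ∈ Ioo (-c) c,
      HasDerivAt (fun s => g (-s)) (-deriv (deriv f) (-t)) t := fun t ht =>
    ((hgg (-t) (hneg t ht)).comp t (hasDerivAt_neg t)).congr_deriv (by simp)
  have hfc' : ContinuousOn (fun s => -f (-s)) (Icc (-c) c) :=
    (hf.continuousOn.comp continuousOn_neg hmaps).neg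
  constructor
  · by_cases h : deriv f (-c) = g (-c)
    · rw [h]
      refine arcA_lt_of_strictAntiOn_curvature hc hf.continuousOn hgC.continuousOn hfg hgg
        hfl hfr ?_ hxI
      exact (hmono.mono Ioo_subset_Icc_self).congr hκ
    · obtain ⟨h0, hk⟩ := deriv_eq_zero_and_graphCurvature_eq_zero hcc hf hl h
      have : arcA c (Real.arctan (deriv f (-c))) x = 0 := by simp [h0, arcA]
      rw [this]
      refine pos_of_deriv2_neg hf.continuousOn hfg hgg hfl hfr (fun t ht => ?_) hxI
      have := hmono hl (Ioo_subset_Icc_self ht) ht.1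
      rw [hk, hκ t ht] at this
      simpa using (div_lt_iff₀ (hden t)).1 this
  · suffices arcA c (Real.arctan (deriv f c)) (-x) < -f (- -x) by
      rw [arcA_neg_abscissa, neg_neg] at this
      rw [arcA_neg_angle]
      linarith
    by_cases h : deriv f c = g c
    · rw [h]
      have key := arcA_lt_of_strictAntiOn_curvature hc hfc'
        (hgC.continuousOn.comp continuousOn_neg hmaps) hfg' hgg'
        (by simp [hfr]) (by simp [hfl]) (fun s hs t ht hst => ?_) hnxI
      · simpa using key
      · have := hmono (Ioo_subset_Icc_self (hneg t ht)) (Ioo_subset_Icc_self (hneg s hs))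
          (neg_lt_neg hst)
        rw [hκ _ (hneg t ht), hκ _ (hneg s hs)] at this
        simpa [neg_div] using this
    · obtain ⟨h0, hk⟩ := deriv_eq_zero_and_graphCurvature_eq_zero hcc hf hr h
      have : arcA c (Real.arctan (deriv f c)) (-x) = 0 := by simp [h0, arcA]
      rw [this]
      refine pos_of_deriv2_neg (f := fun s => -f (-s)) hfc' hfg' hgg' (by simp [hfr])
        (by simp [hfl]) (fun t ht => ?_) hnxI
      have := hmono (Ioo_subset_Icc_self (hneg t ht)) hr (hneg t ht).2
      rw [hk, hκ _ (hneg t ht)] at this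
      exact neg_neg_of_pos ((div_pos_iff_of_pos_right (hden _)).1 this)
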